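/- arXiv:2106.03107 — 2 statements merged into one kernel-verified Lean document; each statement's English description precedes it below -/
import Mathlib

section
/- For all integers s, k with 1 ≤ s < k ≤ n it holds that opt(s) − opt(k) ≤ M·(k−s)/(s+1), where M := M_∞·p̄ − m_∞·p. -/
open scoped BigOperators

/-- Dot product of two vectors in `ℝ^ν`. -/
noncomputable def dot {ν : ℕ} (c x : Fin ν → ℝ) : ℝ := ∑ j, c j * x j

/-- `convComb X k` is the set `X(k)` of all convex combinations of at most `k` points of `X`. -/
def convComb {ν : ℕ} (X : Set (Fin ν → ℝ)) (k : ℕ) : Set (Fin ν → ℝ) :=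
  { x | ∃ (xs : Fin k → (Fin ν → ℝ)) (lam : Fin k → ℝ),
      (∀ i, xs i ∈ X) ∧ (∀ i, 0 ≤ lam i) ∧ (∑ i, lam i) = 1 ∧
      x = ∑ i, lam i • xs i }

/-- The worst-case objective `max_{c ∈ U} cᵀx`. -/
noncomputable def objSup {ν : ℕ} (U : Set (Fin ν → ℝ)) (x : Fin ν → ℝ) : ℝ :=
  sSup ((fun c => dot c x) '' U)

/-- `opt(k) = min_{x ∈ X(k)} max_{c ∈ U} cᵀx`. -/
noncomputable def optVal {ν : ℕ} (X U : Set (Fin ν → ℝ)) (k : ℕ) : ℝ :=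
  sInf (objSup U '' convComb X k)

/-- `‖x‖₀`, the number of nonzero entries of `x`, as a real number. -/
noncomputable def zeroNorm {ν : ℕ} (x : Fin ν → ℝ) : ℝ :=
  ((Finset.univ.filter (fun j => x j ≠ 0)).card : ℝ)

/-- The min-max-min robust value over `k`-tuples of feasible solutions:
`min_{x¹,…,x^k ∈ X} max_{c ∈ U} min_{i} cᵀxⁱ`. -/
noncomputable def minmaxVal {ν : ℕ} (X U : Set (Fin ν → ℝ)) (k : ℕ) : ℝ :=
  sInf { v : ℝ | ∃ xs : Fin k → (Fin ν → ℝ), (∀ i, xs i ∈ X) ∧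
    v = sSup ((fun c => ⨅ i, dot c (xs i)) '' U) }

/-- `app(k)`, the objective value of the `k` solutions `x¹,…,x^k` with largest weights
returned by Algorithm 1: `max_{c ∈ U} min_{i=1,…,k} cᵀxⁱ`. -/
noncomputable def appVal {ν : ℕ} (U : Set (Fin ν → ℝ)) (xs : Fin ν → (Fin ν → ℝ)) (k : ℕ) : ℝ :=
  sSup ((fun c => ⨅ i : {i : Fin ν // (i : ℕ) < k}, dot c (xs i.1)) '' U)

theorem dot_add_smul_sub {n : ℕ} (c x y z : Fin n → ℝ) (a : ℝ) :
    dot c (x + a • (y - z)) = dot c x + a * (dot c y - dot c z) := by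
  simp only [dot, Pi.add_apply, Pi.smul_apply, Pi.sub_apply, smul_eq_mul]
  rw [← Finset.sum_sub_distrib, Finset.mul_sum, ← Finset.sum_add_distrib]
  exact Finset.sum_congr rfl fun j _ => by ring

theorem mul_zeroNorm_eq_sum {n : ℕ} {x : Fin n → ℝ} (hx : ∀ j, x j = 0 ∨ x j = 1) (a : ℝ) :
    a * zeroNorm x = ∑ j, a * x j := by
  rw [zeroNorm, Finset.card_filter, Nat.cast_sum, Finset.mul_sum]
  refine Finset.sum_congr rfl fun j _ => ?_
  rcases hx j with h | h <;> simp [h]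

theorem le_dot_of_binary {n : ℕ} {c x : Fin n → ℝ} {m : ℝ} (hx : ∀ j, x j = 0 ∨ x j = 1)
    (hc : ∀ j, m ≤ c j) : m * zeroNorm x ≤ dot c x := by
  rw [mul_zeroNorm_eq_sum hx]
  refine Finset.sum_le_sum fun j _ => ?_
  rcases hx j with h | h <;> simp [h, hc j]

theorem dot_le_of_binary {n : ℕ} {c x : Fin n → ℝ} {M : ℝ} (hx : ∀ j, x j = 0 ∨ x j = 1)
    (hc : ∀ j, c j ≤ M) : dot c x ≤ M * zeroNorm x := by
  rw [mul_zeroNorm_eq_sum hx]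
  refine Finset.sum_le_sum fun j _ => ?_
  rcases hx j with h | h <;> simp [h, hc j]

theorem convComb_nonempty {n : ℕ} {X : Set (Fin n → ℝ)} (hX : X.Nonempty) (r : ℕ) :
    (convComb X (r + 1)).Nonempty := by
  obtain ⟨x, hx⟩ := hX
  refine ⟨_, fun _ => x, Pi.single 0 1, fun _ => hx, fun i => ?_, ?_, rfl⟩
  · by_cases h : i = 0
    · subst h; simp
    · simp [h]
  · simp

/-- Transferring the smallest weight to another point removes one point from a convex
combination. -/
theorem exists_add_smul_sub_mem_convComb {n : ℕ} {X : Set (Fin n → ℝ)} {r : ℕ}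
    {x : Fin n → ℝ} (hx : x ∈ convComb X (r + 2)) :
    ∃ a : ℝ, 0 ≤ a ∧ a ≤ 1 / ((r : ℝ) + 2) ∧
      ∃ y ∈ X, ∃ z ∈ X, x + a • (y - z) ∈ convComb X (r + 1) := by
  obtain ⟨xs, lam, hxs, hlam, hsum, rfl⟩ := hx
  obtain ⟨i₀, hi₀⟩ := Finite.exists_min lam
  refine ⟨lam i₀, hlam i₀, ?_, xs (i₀.succAbove 0), hxs _, xs i₀, hxs _,
    xs ∘ i₀.succAbove, fun i => lam (i₀.succAbove i) + (Pi.single 0 (lam i₀) : Fin (r + 1) → ℝ) i,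
    fun i => hxs _, fun i => ?_, ?_, ?_⟩
  · rw [le_div_iff₀ (by positivity)]
    have h : ∑ _i : Fin (r + 2), lam i₀ ≤ ∑ i, lam i := Finset.sum_le_sum fun i _ => hi₀ i
    simp only [Finset.sum_const, Finset.card_univ, Fintype.card_fin, nsmul_eq_mul] at h
    push_cast at h
    linarith
  · by_cases h : i = 0
    · subst h; simpa using add_nonneg (hlam _) (hlam _)
    · simpa [h] using hlam _
  · rw [Fin.sum_univ_succAbove lam i₀] at hsum
    rw [Finset.sum_add_distrib, Finset.sum_pi_single']
    simp only [Finset.mem_univ, if_true]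
    linarith
  · have h : ∑ i, (Pi.single 0 (lam i₀) : Fin (r + 1) → ℝ) i • xs (i₀.succAbove i)
        = lam i₀ • xs (i₀.succAbove 0) := by
      rw [Finset.sum_eq_single 0]
      · simp
      · intro i _ hi; simp [hi]
      · simp
    rw [Fin.sum_univ_succAbove (fun i => lam i • xs i) i₀]
    simp only [add_smul, Finset.sum_add_distrib, Function.comp_apply, h, smul_sub]
    abel

theorem bddAbove_dot_image {n : ℕ} {U : Set (Fin n → ℝ)} (hU : IsCompact U) (x : Fin n → ℝ) :
    BddAbove ((fun c => dot c x) '' U) :=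
  hU.bddAbove_image (by unfold dot; fun_prop)

theorem objSup_nonneg {n : ℕ} {U : Set (Fin n → ℝ)} {x : Fin n → ℝ}
    (hU : ∀ c ∈ U, ∀ j, 0 ≤ c j) (hx : ∀ j, 0 ≤ x j) : 0 ≤ objSup U x := by
  refine Real.sSup_nonneg ?_
  rintro _ ⟨c, hc, rfl⟩
  exact Finset.sum_nonneg fun j _ => mul_nonneg (hU c hc j) (hx j)

theorem nonneg_of_mem_convComb {n : ℕ} {X : Set (Fin n → ℝ)} (hX : ∀ x ∈ X, ∀ j, 0 ≤ x j)
    {k : ℕ} {x : Fin n → ℝ} (hx : x ∈ convComb X k) (j : Fin n) : 0 ≤ x j := by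
  obtain ⟨xs, lam, hxs, hlam, -, rfl⟩ := hx
  rw [Finset.sum_apply]
  exact Finset.sum_nonneg fun i _ => mul_nonneg (hlam i) (hX _ (hxs i) j)

theorem optVal_le_optVal_succ_add {n : ℕ} {X U : Set (Fin n → ℝ)} (hXne : X.Nonempty)
    (hX : ∀ x ∈ X, ∀ j, 0 ≤ x j) (hUne : U.Nonempty) (hUcomp : IsCompact U)
    (hU : ∀ c ∈ U, ∀ j, 0 ≤ c j) {M : ℝ} (hM : 0 ≤ M)
    (hdot : ∀ c ∈ U, ∀ y ∈ X, ∀ z ∈ X, dot c y - dot c z ≤ M) (r : ℕ) :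
    optVal X U (r + 1) ≤ optVal X U (r + 2) + M / ((r : ℝ) + 2) := by
  rw [← sub_le_iff_le_add]
  refine le_csInf ((convComb_nonempty hXne _).image _) ?_
  rintro _ ⟨x, hx, rfl⟩
  obtain ⟨a, ha, ha', y, hy, z, hz, hw⟩ := exists_add_smul_sub_mem_convComb hx
  rw [sub_le_iff_le_add]
  have hbdd : BddBelow (objSup U '' convComb X (r + 1)) := by
    refine ⟨0, ?_⟩
    rintro _ ⟨w, hw, rfl⟩
    exact objSup_nonneg hU (nonneg_of_mem_convComb hX hw)
  refine (csInf_le hbdd ⟨_, hw, rfl⟩).trans (csSup_le (hUne.image _) ?_)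
  rintro _ ⟨c, hc, rfl⟩
  have h₁ : dot c x ≤ objSup U x := le_csSup (bddAbove_dot_image hUcomp x) ⟨c, hc, rfl⟩
  have h₂ : a * (dot c y - dot c z) ≤ a * M := mul_le_mul_of_nonneg_left (hdot c hc y hy z hz) ha
  have h₃ : a * M ≤ 1 / ((r : ℝ) + 2) * M := mul_le_mul_of_nonneg_right ha' hM
  rw [one_div_mul_eq_div] at h₃
  simp only [dot_add_smul_sub]
  linarith

/-- For `1 ≤ s < k ≤ n`, `opt(s) − opt(k) ≤ M·(k−s)/(s+1)`
with `M = M_∞·p̄ − m_∞·p`. -/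
theorem stmt4 (n : ℕ) (hn : 0 < n)
    (X : Set (Fin n → ℝ)) (hXfin : X.Finite) (hXne : X.Nonempty)
    (hXbin : ∀ x ∈ X, ∀ j, x j = 0 ∨ x j = 1)
    (U : Set (Fin n → ℝ)) (hUne : U.Nonempty) (hUcomp : IsCompact U) (hUconv : Convex ℝ U)
    (m_inf M_inf : ℝ) (hm : 0 < m_inf) (hmM : m_inf ≤ M_inf)
    (hc : ∀ c ∈ U, ∀ j, m_inf ≤ c j ∧ c j ≤ M_inf)
    (p pbar : ℝ) (hp0 : 0 ≤ p) (hppbar : p ≤ pbar)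
    (hpx : ∀ x ∈ X, p ≤ zeroNorm x ∧ zeroNorm x ≤ pbar)
    (s k : ℕ) (hs : 1 ≤ s) (hsk : s < k) (hkn : k ≤ n) :
    optVal X U s - optVal X U k ≤
      (M_inf * pbar - m_inf * p) * (((k : ℝ) - s) / ((s : ℝ) + 1)) := by
  have hMdot : ∀ c ∈ U, ∀ y ∈ X, ∀ z ∈ X,
      dot c y - dot c z ≤ M_inf * pbar - m_inf * p := by
    intro c hcU y hy z hz
    have h₁ := dot_le_of_binary (hXbin y hy) fun j => (hc c hcU j).2
    have h₂ := le_dot_of_binary (hXbin z hz) fun j => (hc c hcU j).1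
    have h₃ := mul_le_mul_of_nonneg_left (hpx y hy).2 (hm.le.trans hmM)
    have h₄ := mul_le_mul_of_nonneg_left (hpx z hz).1 hm.le
    linarith
  have hM : 0 ≤ M_inf * pbar - m_inf * p :=
    sub_nonneg.2 (mul_le_mul hmM hppbar hp0 (hm.le.trans hmM))
  have hXnn : ∀ x ∈ X, ∀ j, 0 ≤ x j := fun x hx j => by
    rcases hXbin x hx j with h | h <;> simp [h]
  have step := optVal_le_optVal_succ_add hXne hXnn hUne hUcomp
    (fun c hcU j => hm.le.trans (hc c hcU j).1) hM hMdot
  generalize M_inf * pbar - m_inf * p = M at hM step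
  obtain ⟨r, rfl⟩ := Nat.exists_eq_add_of_le' hs
  obtain ⟨d, rfl⟩ := Nat.exists_eq_add_of_le hsk.le
  have key : ∀ d : ℕ, optVal X U (r + 1) - optVal X U (r + 1 + d) ≤ d * (M / ((r : ℝ) + 2)) := by
    intro d
    induction d with
    | zero => simp
    | succ d ih =>
      have h := step (r + d)
      rw [show r + d + 1 = r + 1 + d by ring, show r + d + 2 = r + 1 + (d + 1) by ring] at h
      have h' : M / (((r + d : ℕ) : ℝ) + 2) ≤ M / ((r : ℝ) + 2) := by
        gcongr
        exact Nat.le_add_right r d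
      push_cast at h' h ⊢
      linarith
  refine (key d).trans_eq ?_
  push_cast
  ring
end

section
/- Assume additionally p > 0. For all integers s, k with 1 ≤ s < k ≤ n it holds that opt(s) ≤ (1 + M̃·(k−s)/(s+1))·opt(k), where M̃ := (M_∞/m_∞)·(p̄/p); in particular, if p = p̄ then opt(s) ≤ (1 + (M_∞/m_∞)·(k−s)/(s+1))·opt(k). -/
open scoped BigOperators

lemma dot_sum_smul {ν : ℕ} {ι : Type*} (c : Fin ν → ℝ) (T : Finset ι) (a : ι → ℝ)
    (x : ι → Fin ν → ℝ) : dot c (∑ i ∈ T, a i • x i) = ∑ i ∈ T, a i * dot c (x i) := by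
  simp only [dot, Finset.sum_apply, Pi.smul_apply, smul_eq_mul, Finset.mul_sum]
  rw [Finset.sum_comm]
  exact Finset.sum_congr rfl fun i _ => Finset.sum_congr rfl fun j _ => by ring

lemma zeroNorm_eq_sum {ν : ℕ} {x : Fin ν → ℝ} (hx : ∀ j, x j = 0 ∨ x j = 1) :
    zeroNorm x = ∑ j, x j := by
  rw [zeroNorm, Finset.card_filter, Nat.cast_sum]
  refine Finset.sum_congr rfl fun j _ => ?_
  rcases hx j with h | h <;> simp [h]

lemma dot_bounds_of_binary {ν : ℕ} {c x : Fin ν → ℝ} {m M : ℝ} (hx : ∀ j, x j = 0 ∨ x j = 1)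
    (hc : ∀ j, m ≤ c j ∧ c j ≤ M) : m * zeroNorm x ≤ dot c x ∧ dot c x ≤ M * zeroNorm x := by
  have hx0 : ∀ j, 0 ≤ x j := fun j => by rcases hx j with h | h <;> simp [h]
  rw [zeroNorm_eq_sum hx, dot, Finset.mul_sum, Finset.mul_sum]
  exact ⟨Finset.sum_le_sum fun j _ => mul_le_mul_of_nonneg_right (hc j).1 (hx0 j),
    Finset.sum_le_sum fun j _ => mul_le_mul_of_nonneg_right (hc j).2 (hx0 j)⟩

/-- Any bounds for `cᵀx` on `X` carry over to the convex combinations. -/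
lemma dot_bounds_of_mem_convComb {ν k : ℕ} {X : Set (Fin ν → ℝ)} {c y : Fin ν → ℝ} {a b : ℝ}
    (h : ∀ x ∈ X, a ≤ dot c x ∧ dot c x ≤ b) (hy : y ∈ convComb X k) :
    a ≤ dot c y ∧ dot c y ≤ b := by
  obtain ⟨xs, lam, hxs, hlam, hsum, rfl⟩ := hy
  rw [dot_sum_smul]
  constructor
  · calc a = ∑ i, lam i * a := by rw [← Finset.sum_mul, hsum, one_mul]
      _ ≤ _ := Finset.sum_le_sum fun i _ => mul_le_mul_of_nonneg_left (h _ (hxs i)).1 (hlam i)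
  · calc _ ≤ ∑ i, lam i * b :=
          Finset.sum_le_sum fun i _ => mul_le_mul_of_nonneg_left (h _ (hxs i)).2 (hlam i)
      _ = b := by rw [← Finset.sum_mul, hsum, one_mul]

/-- Some `s` of the terms of a finite sum have at least the average weight. -/
lemma exists_subset_card_eq_mul_sum_le {ι : Type*} (f : ι → ℝ) (s : ℕ) (A : Finset ι)
    (hs : s ≤ A.card) :
    ∃ T ⊆ A, T.card = s ∧ (s : ℝ) * ∑ i ∈ A, f i ≤ A.card * ∑ i ∈ T, f i := by
  classical
  induction A using Finset.strongInduction with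
  | H A ih =>
    rcases hs.eq_or_lt with h | h
    · exact ⟨A, subset_rfl, h.symm, by rw [h]⟩
    obtain ⟨a, ha, hmin⟩ := A.exists_min_image f (Finset.card_pos.1 (by omega))
    have hcard : (A.erase a).card + 1 = A.card := Finset.card_erase_add_one ha
    obtain ⟨T, hTA, hTs, hT⟩ := ih (A.erase a) (Finset.erase_ssubset ha) (by omega)
    refine ⟨T, hTA.trans (Finset.erase_subset _ _), hTs, ?_⟩
    have hTa : (s : ℝ) * f a ≤ ∑ i ∈ T, f i := by
      rw [← hTs, ← nsmul_eq_mul]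
      exact Finset.card_nsmul_le_sum _ _ _ fun i hi => hmin i (Finset.mem_of_mem_erase (hTA hi))
    rw [← Finset.add_sum_erase A f ha, ← hcard]
    push_cast
    linarith

/-- A convex combination supported on a finite set of `s` indices lies in `X(s)`. -/
lemma sum_smul_mem_convComb {ν s : ℕ} {ι : Type*} {X : Set (Fin ν → ℝ)} {T : Finset ι}
    (hT : T.card = s) {w : ι → ℝ} {x : ι → Fin ν → ℝ} (hx : ∀ i, x i ∈ X) (hw : ∀ i, 0 ≤ w i)
    (hsum : ∑ i ∈ T, w i = 1) : ∑ i ∈ T, w i • x i ∈ convComb X s := by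
  let e : Fin s ≃ T := (T.equivFinOfCardEq hT).symm
  refine ⟨fun i => x (e i), fun i => w (e i), fun i => hx _, fun i => hw _, ?_, ?_⟩
  · rw [e.sum_comp fun t : T => w t, Finset.sum_coe_sort T w, hsum]
  · rw [e.sum_comp fun t : T => w t • x t, Finset.sum_coe_sort T fun i => w i • x i]

/-- Dropping all but the `s` largest weights of a convex combination of `k` points, and spreading
the lost weight evenly, increases `cᵀx` by at most `b (k - s) / k`. -/
lemma exists_mem_convComb_dot_le {ν s k : ℕ} {X C : Set (Fin ν → ℝ)} {b : ℝ} (hs : 1 ≤ s)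
    (hsk : s ≤ k) (h : ∀ c ∈ C, ∀ x ∈ X, 0 ≤ dot c x ∧ dot c x ≤ b) {x : Fin ν → ℝ}
    (hx : x ∈ convComb X k) :
    ∃ y ∈ convComb X s, ∃ δ : ℝ, 0 ≤ δ ∧ δ * k ≤ k - s ∧ ∀ c ∈ C, dot c y ≤ dot c x + δ * b := by
  obtain ⟨xs, lam, hxs, hlam, hsum, rfl⟩ := hx
  obtain ⟨T, -, hTs, hT⟩ := exists_subset_card_eq_mul_sum_le lam s Finset.univ (by simpa using hsk)
  rw [hsum, Finset.card_univ, Fintype.card_fin, mul_one] at hT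
  have hs0 : (0 : ℝ) < s := by exact_mod_cast hs
  have hδ : 0 ≤ 1 - ∑ i ∈ T, lam i := by
    rw [sub_nonneg, ← hsum]
    exact Finset.sum_le_sum_of_subset_of_nonneg (Finset.subset_univ T) fun i _ _ => hlam i
  set δ := 1 - ∑ i ∈ T, lam i with hδdef
  refine ⟨∑ i ∈ T, (lam i + δ / s) • xs i, sum_smul_mem_convComb hTs hxs
    (fun i => add_nonneg (hlam i) (by positivity)) ?_, δ, hδ, by rw [hδdef]; linarith,
    fun c hcC => ?_⟩
  · rw [Finset.sum_add_distrib, Finset.sum_const, hTs, nsmul_eq_mul, mul_div_cancel₀ _ hs0.ne']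
    linarith
  · rw [dot_sum_smul, dot_sum_smul]
    simp only [add_mul, Finset.sum_add_distrib]
    refine add_le_add (Finset.sum_le_sum_of_subset_of_nonneg (Finset.subset_univ T)
      fun i _ _ => mul_nonneg (hlam i) (h c hcC _ (hxs i)).1) ?_
    calc ∑ i ∈ T, δ / s * dot c (xs i) ≤ ∑ _i ∈ T, δ / s * b :=
          Finset.sum_le_sum fun i _ =>
            mul_le_mul_of_nonneg_left (h c hcC _ (hxs i)).2 (by positivity)
      _ = δ * b := by
          rw [Finset.sum_const, hTs, nsmul_eq_mul]
          field_simp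

/-- If `0 < a ≤ cᵀx ≤ b` for all `c ∈ U`, `x ∈ X`, then
`opt(s) ≤ (1 + (b / a) (k - s) / (s + 1)) opt(k)`. -/
lemma optVal_le_mul_optVal {ν s k : ℕ} {X U : Set (Fin ν → ℝ)} {a b : ℝ} (hX : X.Nonempty)
    (hU : U.Nonempty) (ha : 0 < a) (h : ∀ c ∈ U, ∀ x ∈ X, a ≤ dot c x ∧ dot c x ≤ b)
    (hs : 1 ≤ s) (hsk : s < k) :
    optVal X U s ≤ (1 + b / a * (((k : ℝ) - s) / ((s : ℝ) + 1))) * optVal X U k := by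
  obtain ⟨x₀, hx₀⟩ := hX
  obtain ⟨c₀, hc₀⟩ := hU
  have hb : 0 < b := ha.trans_le ((h c₀ hc₀ x₀ hx₀).1.trans (h c₀ hc₀ x₀ hx₀).2)
  have hks : (s : ℝ) + 1 ≤ k := by exact_mod_cast hsk
  have hr : 0 ≤ ((k : ℝ) - s) / ((s : ℝ) + 1) := div_nonneg (by linarith) (by positivity)
  have hK : 0 < 1 + b / a * (((k : ℝ) - s) / ((s : ℝ) + 1)) := by positivity
  have hle : ∀ l, ∀ y ∈ convComb X l, ∀ c ∈ U, dot c y ≤ objSup U y := fun l y hy c hc =>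
    le_csSup ⟨b, by
      rintro _ ⟨c', hc', rfl⟩
      exact (dot_bounds_of_mem_convComb (h c' hc') hy).2⟩ ⟨c, hc, rfl⟩
  have hbdd : BddBelow (objSup U '' convComb X s) := by
    refine ⟨a, ?_⟩
    rintro _ ⟨y, hy, rfl⟩
    exact (dot_bounds_of_mem_convComb (h c₀ hc₀) hy).1.trans (hle s y hy c₀ hc₀)
  have hne : (convComb X k).Nonempty :=
    ⟨_, sum_smul_mem_convComb (T := Finset.univ) (s := k) (ι := Fin k) (by simp) (fun _ => hx₀)
      (w := fun _ => (k : ℝ)⁻¹) (fun _ => by positivity) (by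
        have : (k : ℝ) ≠ 0 := by exact_mod_cast (by omega : k ≠ 0)
        simp [this])⟩
  rw [← div_le_iff₀' hK]
  refine le_csInf (hne.image _) ?_
  rintro _ ⟨x, hx, rfl⟩
  rw [div_le_iff₀' hK]
  obtain ⟨y, hy, δ, hδ, hδk, hyx⟩ := exists_mem_convComb_dot_le hs hsk.le
    (fun c hc z hz => ⟨ha.le.trans (h c hc z hz).1, (h c hc z hz).2⟩) hx
  have hδr : δ ≤ ((k : ℝ) - s) / ((s : ℝ) + 1) := by
    rw [le_div_iff₀ (by positivity)]
    exact (mul_le_mul_of_nonneg_left hks hδ).trans hδk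
  refine (csInf_le hbdd ⟨y, hy, rfl⟩).trans (csSup_le ⟨_, c₀, hc₀, rfl⟩ ?_)
  rintro _ ⟨c, hc, rfl⟩
  have hax := (dot_bounds_of_mem_convComb (h c hc) hx).1
  calc dot c y ≤ dot c x + δ * b := hyx c hc
    _ = dot c x + b / a * δ * a := by field_simp
    _ ≤ dot c x + b / a * (((k : ℝ) - s) / ((s : ℝ) + 1)) * dot c x := by gcongr
    _ = (1 + b / a * (((k : ℝ) - s) / ((s : ℝ) + 1))) * dot c x := by ring
    _ ≤ _ := mul_le_mul_of_nonneg_left (hle k x hx c hc) hK.le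

/-- Assume `p > 0`. For `1 ≤ s < k ≤ n`,
`opt(s) ≤ (1 + M̃·(k−s)/(s+1))·opt(k)` with `M̃ = (M_∞/m_∞)·(p̄/p)`;
in particular if `p = p̄` then `opt(s) ≤ (1 + (M_∞/m_∞)·(k−s)/(s+1))·opt(k)`. -/
theorem stmt9 (n : ℕ) (hn : 0 < n)
    (X : Set (Fin n → ℝ)) (hXfin : X.Finite) (hXne : X.Nonempty)
    (hXbin : ∀ x ∈ X, ∀ j, x j = 0 ∨ x j = 1)
    (U : Set (Fin n → ℝ)) (hUne : U.Nonempty) (hUcomp : IsCompact U) (hUconv : Convex ℝ U)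
    (m_inf M_inf : ℝ) (hm : 0 < m_inf) (hmM : m_inf ≤ M_inf)
    (hc : ∀ c ∈ U, ∀ j, m_inf ≤ c j ∧ c j ≤ M_inf)
    (p pbar : ℝ) (hp0 : 0 ≤ p) (hppbar : p ≤ pbar)
    (hpx : ∀ x ∈ X, p ≤ zeroNorm x ∧ zeroNorm x ≤ pbar)
    (hppos : 0 < p)
    (s k : ℕ) (hs : 1 ≤ s) (hsk : s < k) (hkn : k ≤ n) :
    optVal X U s ≤
      (1 + (M_inf / m_inf) * (pbar / p) * (((k : ℝ) - s) / ((s : ℝ) + 1))) * optVal X U k ∧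
    (p = pbar →
      optVal X U s ≤
        (1 + (M_inf / m_inf) * (((k : ℝ) - s) / ((s : ℝ) + 1))) * optVal X U k) := by
  have h := optVal_le_mul_optVal hXne hUne (mul_pos hm hppos) (b := M_inf * pbar)
    (fun c hcU x hx => by
      obtain ⟨h1, h2⟩ := dot_bounds_of_binary (hXbin x hx) (hc c hcU)
      exact ⟨(mul_le_mul_of_nonneg_left (hpx x hx).1 hm.le).trans h1,
        h2.trans (mul_le_mul_of_nonneg_left (hpx x hx).2 (hm.le.trans hmM))⟩) hs hsk
  rw [mul_div_mul_comm] at h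
  refine ⟨h, ?_⟩
  rintro rfl
  rwa [div_self hppos.ne', mul_one] at h
end
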